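/- Let I be an infinite set and let Y be a finite-dimensional smooth Banach space. Then the norm of the projective tensor product c_0(I) ⊗̂_π Y is strongly subdifferentiable (SSD) at every point of its unit sphere. -/

import Mathlib

/-- The set of all sums `Σ ‖u i‖ * ‖v i‖` over finite representations
`z = Σ u i ⊗ v i` of `z` as a sum of elementary tensors. -/
def projRepSums {X Y Z : Type*} [NormedAddCommGroup X] [NormedSpace ℝ X]
    [NormedAddCommGroup Y] [NormedSpace ℝ Y] [NormedAddCommGroup Z] [NormedSpace ℝ Z]
    (tp : X →ₗ[ℝ] Y →ₗ[ℝ] Z) (z : Z) : Set ℝ :=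
  { r | ∃ (k : ℕ) (u : Fin k → X) (v : Fin k → Y),
      z = ∑ i, tp (u i) (v i) ∧ r = ∑ i, ‖u i‖ * ‖v i‖ }

/-- The Banach space `Z`, together with the bilinear map `tp`, is (an isometric copy of) the
projective tensor product `X ⊗̂_π Y`: the span of the elementary tensors is dense in `Z`, and the
norm of any finite sum of elementary tensors is its projective norm, i.e. the infimum of
`Σ ‖u i‖ * ‖v i‖` over all finite representations. -/
structure IsProjectiveTensorProduct {X Y Z : Type*} [NormedAddCommGroup X] [NormedSpace ℝ X]
    [NormedAddCommGroup Y] [NormedSpace ℝ Y] [NormedAddCommGroup Z] [NormedSpace ℝ Z]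
    [CompleteSpace Z] (tp : X →ₗ[ℝ] Y →ₗ[ℝ] Z) : Prop where
  dense_span : Dense ((Submodule.span ℝ
    (Set.range fun xy : X × Y => tp xy.1 xy.2) : Submodule ℝ Z) : Set Z)
  norm_eq : ∀ (k : ℕ) (u : Fin k → X) (v : Fin k → Y),
    ‖∑ i, tp (u i) (v i)‖ = sInf (projRepSums tp (∑ i, tp (u i) (v i)))

/-- `z` is an SSD point of the unit sphere of `Z`: `‖z‖ = 1` and the one-sided limit
`lim_{t → 0⁺} (‖z + t • h‖ - 1) / t` exists uniformly in `h` on the unit sphere of `Z`. -/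
def IsSSDPoint {Z : Type*} [NormedAddCommGroup Z] [NormedSpace ℝ Z] (z : Z) : Prop :=
  ‖z‖ = 1 ∧ ∃ G : Z → ℝ, ∀ ε > (0 : ℝ), ∃ δ > (0 : ℝ), ∀ t : ℝ, 0 < t → t < δ →
    ∀ h : Z, ‖h‖ = 1 → |(‖z + t • h‖ - 1) / t - G h| < ε

/-- A Banach space `Y` is smooth if every point of its unit sphere has a unique norming
functional. -/
def SmoothNormedSpace (Y : Type*) [NormedAddCommGroup Y] [NormedSpace ℝ Y] : Prop :=
  ∀ y : Y, ‖y‖ = 1 → ∃! f : Y →L[ℝ] ℝ, ‖f‖ = 1 ∧ f y = 1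

open ZeroAtInftyContinuousMap in
lemma norm_zeroAtInfty_le {I : Type*} [TopologicalSpace I] (f : ZeroAtInftyContinuousMap I ℝ)
    {C : ℝ} (hC : 0 ≤ C) (h : ∀ i, |f i| ≤ C) : ‖f‖ ≤ C := by
  rw [← norm_toBCF_eq_norm, BoundedContinuousFunction.norm_le hC]
  exact h

open ZeroAtInftyContinuousMap in
lemma abs_apply_le_norm_zeroAtInfty {I : Type*} [TopologicalSpace I]
    (f : ZeroAtInftyContinuousMap I ℝ) (i : I) : |f i| ≤ ‖f‖ := by
  rw [← norm_toBCF_eq_norm]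
  exact f.toBCF.norm_coe_le_norm i

lemma finite_setOf_lt_abs_zeroAtInfty {I : Type*} [TopologicalSpace I] [DiscreteTopology I]
    (f : ZeroAtInftyContinuousMap I ℝ) {r : ℝ} (hr : 0 < r) : {i | r < |f i|}.Finite := by
  have h := f.zero_at_infty'
  rw [Filter.cocompact_eq_cofinite] at h
  have h2 := (h.eventually (Metric.ball_mem_nhds (0 : ℝ) hr))
  rw [Filter.eventually_cofinite] at h2
  refine h2.subset fun i hi => ?_
  exact fun h => lt_asymm hi (mem_ball_zero_iff.1 h)

open Classical in
/-- The `i`-th coordinate function in `c₀(I)`. -/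
noncomputable def c0Single {I : Type*} [TopologicalSpace I] [DiscreteTopology I] (i : I) :
    ZeroAtInftyContinuousMap I ℝ where
  toFun := Pi.single i 1
  continuous_toFun := continuous_of_discreteTopology
  zero_at_infty' := by
    rw [Filter.cocompact_eq_cofinite]
    refine tendsto_const_nhds.congr' ?_
    filter_upwards [(Set.finite_singleton i).compl_mem_cofinite] with j hj
    exact (Pi.single_eq_of_ne (M := fun _ => ℝ) hj _).symm

/-- The restriction of an element of `c₀(I)` to a finite set of coordinates. -/
noncomputable def c0Restrict {I : Type*} [TopologicalSpace I] [DiscreteTopology I] (A : Finset I)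
    (f : ZeroAtInftyContinuousMap I ℝ) : ZeroAtInftyContinuousMap I ℝ :=
  ∑ a ∈ A, f a • c0Single a

open Classical in
lemma c0Restrict_apply {I : Type*} [TopologicalSpace I] [DiscreteTopology I] (A : Finset I)
    (f : ZeroAtInftyContinuousMap I ℝ) (i : I) :
    c0Restrict A f i = if i ∈ A then f i else 0 := by
  have h : ∀ B : Finset I, (∑ a ∈ B, f a • c0Single a : ZeroAtInftyContinuousMap I ℝ) i
      = ∑ a ∈ B, f a * (Pi.single a 1 : I → ℝ) i := by
    intro B
    induction B using Finset.induction_on with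
    | empty => simp
    | insert a s ha ih =>
      rw [Finset.sum_insert ha, Finset.sum_insert ha, ZeroAtInftyContinuousMap.add_apply, ih]
      rfl
  rw [c0Restrict, h]
  simp [Pi.single_apply]

lemma norm_c0Restrict_le {I : Type*} [TopologicalSpace I] [DiscreteTopology I] (A : Finset I)
    (f : ZeroAtInftyContinuousMap I ℝ) : ‖c0Restrict A f‖ ≤ ‖f‖ := by
  classical
  refine norm_zeroAtInfty_le _ (norm_nonneg _) fun i => ?_
  rw [c0Restrict_apply]
  split_ifs
  · exact abs_apply_le_norm_zeroAtInfty f i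
  · simp

lemma norm_sub_c0Restrict_le {I : Type*} [TopologicalSpace I] [DiscreteTopology I] (A : Finset I)
    (f : ZeroAtInftyContinuousMap I ℝ) : ‖f - c0Restrict A f‖ ≤ ‖f‖ := by
  classical
  refine norm_zeroAtInfty_le _ (norm_nonneg _) fun i => ?_
  rw [ZeroAtInftyContinuousMap.sub_apply, c0Restrict_apply]
  split_ifs
  · simp
  · simpa using abs_apply_le_norm_zeroAtInfty f i

/-- Uniform convexity of the dual of a finite-dimensional smooth space. -/
lemma exists_lt_one_norm_lt_of_smooth {Y : Type*} [NormedAddCommGroup Y] [NormedSpace ℝ Y]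
    [FiniteDimensional ℝ Y] (hY : SmoothNormedSpace Y) {ε : ℝ} (hε : 0 < ε) :
    ∃ c : ℝ, c < 1 ∧ ∀ (φ ψ : Y →L[ℝ] ℝ) (y : Y), ‖φ + ψ‖ ≤ 1 → ‖φ - ψ‖ ≤ 1 → ‖y‖ = 1 →
      c ≤ φ y → ‖ψ‖ < ε := by
  have : ProperSpace Y := FiniteDimensional.proper ℝ Y
  have : ProperSpace (Y →L[ℝ] ℝ) := FiniteDimensional.proper ℝ _
  let K : Set ((Y →L[ℝ] ℝ) × (Y →L[ℝ] ℝ) × Y) :=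
    {p | ‖p.1 + p.2.1‖ ≤ 1 ∧ ‖p.1 - p.2.1‖ ≤ 1 ∧ ‖p.2.2‖ = 1 ∧ ε ≤ ‖p.2.1‖}
  have hKc : IsCompact K := by
    refine Metric.isCompact_of_isClosed_isBounded ?_ ?_
    · refine IsClosed.inter ?_ (IsClosed.inter ?_ (IsClosed.inter ?_ ?_))
      · exact isClosed_le (continuous_fst.add continuous_snd.fst).norm continuous_const
      · exact isClosed_le (continuous_fst.sub continuous_snd.fst).norm continuous_const
      · exact isClosed_eq continuous_snd.snd.norm continuous_const
      · exact isClosed_le continuous_const continuous_snd.fst.norm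
    · refine (Metric.isBounded_closedBall (x := 0) (r := 1)).subset fun p hp => ?_
      obtain ⟨h1, h2, h3, -⟩ := hp
      have e1 : (2 : ℝ) • p.1 = (p.1 + p.2.1) + (p.1 - p.2.1) := by rw [two_smul]; abel
      have e2 : (2 : ℝ) • p.2.1 = (p.1 + p.2.1) - (p.1 - p.2.1) := by rw [two_smul]; abel
      have n1 := norm_add_le (p.1 + p.2.1) (p.1 - p.2.1)
      have n2 := norm_sub_le (p.1 + p.2.1) (p.1 - p.2.1)
      rw [← e1, norm_smul] at n1
      rw [← e2, norm_smul] at n2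
      norm_num at n1 n2
      rw [mem_closedBall_zero_iff, norm_prod_le_iff, norm_prod_le_iff]
      exact ⟨by linarith, by linarith, h3.le⟩
  rcases K.eq_empty_or_nonempty with hK | hK
  · refine ⟨0, zero_lt_one, fun φ ψ y h1 h2 h3 _ => ?_⟩
    by_contra! h
    exact (Set.eq_empty_iff_forall_notMem.1 hK (φ, ψ, y)) ⟨h1, h2, h3, h⟩
  · obtain ⟨⟨φ, ψ, y⟩, ⟨h1, h2, h3, h4⟩, hmax⟩ := hKc.exists_isMaxOn hK
      (f := fun p => p.1 p.2.2) (by fun_prop)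
    simp only at h1 h2 h3 h4
    have b1 : φ y + ψ y ≤ 1 := by
      have := (le_abs_self _).trans ((φ + ψ).le_of_opNorm_le h1 y)
      simpa [h3] using this
    have b2 : φ y - ψ y ≤ 1 := by
      have := (le_abs_self _).trans ((φ - ψ).le_of_opNorm_le h2 y)
      simpa [h3] using this
    have hlt : φ y < 1 := by
      by_contra! hge
      have n1 : 1 ≤ ‖φ + ψ‖ := by
        have := (le_abs_self _).trans ((φ + ψ).le_opNorm y)
        rw [h3, mul_one, add_apply] at this
        linarith
      have n2 : 1 ≤ ‖φ - ψ‖ := by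
        have := (le_abs_self _).trans ((φ - ψ).le_opNorm y)
        rw [h3, mul_one, sub_apply] at this
        linarith
      have heq : φ + ψ = φ - ψ := (hY y h3).unique
        ⟨le_antisymm h1 n1, by rw [add_apply]; linarith⟩
        ⟨le_antisymm h2 n2, by rw [sub_apply]; linarith⟩
      have h0 : ψ = 0 := by
        have e2 : (2 : ℝ) • ψ = (φ + ψ) - (φ - ψ) := by rw [two_smul]; abel
        rw [heq, sub_self] at e2
        exact (smul_eq_zero.1 e2).resolve_left two_ne_zero
      rw [h0, norm_zero] at h4
      linarith
    refine ⟨(φ y + 1) / 2, by linarith, fun φ' ψ' y' h1' h2' h3' hc => ?_⟩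
    by_contra! h
    have := hmax (show (φ', ψ', y') ∈ K from ⟨h1', h2', h3', h⟩)
    exact absurd (hc.trans this) (by dsimp only; linarith)

lemma norm_apply_le_of_almost_norming {I : Type*} [TopologicalSpace I]
    {Y : Type*} [NormedAddCommGroup Y] [NormedSpace ℝ Y] {c ε : ℝ}
    (hc : ∀ (φ ψ : Y →L[ℝ] ℝ) (y : Y), ‖φ + ψ‖ ≤ 1 → ‖φ - ψ‖ ≤ 1 → ‖y‖ = 1 →
      c ≤ φ y → ‖ψ‖ < ε)
    (T : ZeroAtInftyContinuousMap I ℝ →L[ℝ] Y →L[ℝ] ℝ) (hT : ‖T‖ ≤ 1)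
    {u : ZeroAtInftyContinuousMap I ℝ} {v : Y} (hu : 0 < ‖u‖) (hv : 0 < ‖v‖)
    (huv : c * (‖u‖ * ‖v‖) ≤ T u v) (w : ZeroAtInftyContinuousMap I ℝ)
    (hw : ∀ i, ‖u‖ / 2 < |u i| → w i = 0) :
    ‖T w‖ ≤ 2 * ε * ‖w‖ := by
  rcases (norm_nonneg w).eq_or_lt with hw0 | hw0
  · rw [norm_eq_zero.1 hw0.symm]; simp
  have key : ∀ s : ℝ, |s| = 1 / 2 → ‖‖u‖⁻¹ • u + (s * ‖w‖⁻¹) • w‖ ≤ 1 := by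
    intro s hs
    refine norm_zeroAtInfty_le _ zero_le_one fun i => ?_
    rw [ZeroAtInftyContinuousMap.add_apply, ZeroAtInftyContinuousMap.smul_apply,
      ZeroAtInftyContinuousMap.smul_apply, smul_eq_mul, smul_eq_mul]
    refine (abs_add_le _ _).trans ?_
    rw [abs_mul, abs_mul, abs_mul, hs, abs_of_pos (inv_pos.2 hu), abs_of_pos (inv_pos.2 hw0)]
    have hui : ‖u‖⁻¹ * |u i| ≤ 1 := by
      rw [inv_mul_le_iff₀ hu, mul_one]; exact abs_apply_le_norm_zeroAtInfty u i
    have hwi : ‖w‖⁻¹ * |w i| ≤ 1 := by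
      rw [inv_mul_le_iff₀ hw0, mul_one]; exact abs_apply_le_norm_zeroAtInfty w i
    rcases lt_or_ge (‖u‖ / 2) |u i| with h | h
    · rw [hw i h]; simpa using hui
    · have : ‖u‖⁻¹ * |u i| ≤ 1 / 2 := by
        rw [inv_mul_le_iff₀ hu]; linarith
      linarith
  have bound : ∀ x, ‖x‖ ≤ 1 → ‖T x‖ ≤ 1 := fun x hx =>
    (T.le_opNorm x).trans (mul_le_one₀ hT (norm_nonneg _) hx)
  have h := hc (T (‖u‖⁻¹ • u)) (T ((1 / 2 * ‖w‖⁻¹) • w)) (‖v‖⁻¹ • v)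
    (by rw [← map_add]; exact bound _ (key _ (by norm_num)))
    (by
      have e : ‖u‖⁻¹ • u - (1 / 2 * ‖w‖⁻¹) • w = ‖u‖⁻¹ • u + (-(1 / 2) * ‖w‖⁻¹) • w := by
        module
      rw [← map_sub, e]
      exact bound _ (key _ (by norm_num)))
    (by rw [norm_smul, norm_inv, norm_norm, inv_mul_cancel₀ hv.ne'])
    (by
      rw [map_smul, map_smul, smul_apply, smul_eq_mul, smul_eq_mul,
        ← mul_assoc, ← mul_inv, mul_comm, ← div_eq_mul_inv, le_div_iff₀ (by positivity),
        mul_comm ‖v‖]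
      exact huv)
  rw [map_smul, norm_smul, Real.norm_of_nonneg (by positivity), mul_assoc,
    inv_mul_eq_div] at h
  have h' : ‖T w‖ / ‖w‖ < 2 * ε := by linarith
  exact ((div_lt_iff₀ hw0).1 h').le

section DifferenceQuotient

variable {Z : Type*} [NormedAddCommGroup Z] [NormedSpace ℝ Z]

lemma normQuotient_mono {z : Z} (hz : ‖z‖ = 1) (h : Z) {s t : ℝ} (hs : 0 < s) (hst : s ≤ t) :
    (‖z + s • h‖ - 1) / s ≤ (‖z + t • h‖ - 1) / t := by
  have ht := hs.trans_le hst
  rw [div_le_div_iff₀ hs ht]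
  have e : t • (z + s • h) = (t - s) • z + s • (z + t • h) := by module
  have := norm_add_le ((t - s) • z) (s • (z + t • h))
  rw [← e, norm_smul, norm_smul, norm_smul, Real.norm_of_nonneg ht.le, Real.norm_of_nonneg hs.le,
    Real.norm_of_nonneg (sub_nonneg.2 hst), hz] at this
  linarith

lemma normQuotient_lipschitz (z h k : Z) {t : ℝ} (ht : 0 < t) :
    (‖z + t • h‖ - 1) / t ≤ (‖z + t • k‖ - 1) / t + ‖h - k‖ := by
  rw [div_add' _ _ _ ht.ne', div_le_div_iff_of_pos_right ht]
  have e : z + t • h = (z + t • k) + t • (h - k) := by module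
  have := norm_add_le (z + t • k) (t • (h - k))
  rw [← e, norm_smul, Real.norm_of_nonneg ht.le] at this
  linarith

lemma neg_norm_le_normQuotient {z : Z} (hz : ‖z‖ = 1) (h : Z) {t : ℝ} (ht : 0 < t) :
    -‖h‖ ≤ (‖z + t • h‖ - 1) / t := by
  have := normQuotient_lipschitz z 0 h ht
  simp only [smul_zero, add_zero, hz, sub_self, zero_div, zero_sub, norm_neg] at this
  linarith

/-- The one-sided derivative of the norm at a point `z` of the unit sphere. -/
noncomputable def normDeriv (z h : Z) : ℝ :=
  ⨅ t : Set.Ioi (0 : ℝ), (‖z + (t : ℝ) • h‖ - 1) / t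

lemma normDeriv_le {z : Z} (hz : ‖z‖ = 1) (h : Z) {t : ℝ} (ht : 0 < t) :
    normDeriv z h ≤ (‖z + t • h‖ - 1) / t :=
  ciInf_le (f := fun t : Set.Ioi (0 : ℝ) => (‖z + (t : ℝ) • h‖ - 1) / t)
    ⟨-‖h‖, by rintro _ ⟨s, rfl⟩; exact neg_norm_le_normQuotient hz h s.2⟩ ⟨t, ht⟩

lemma exists_normQuotient_lt {z : Z} (hz : ‖z‖ = 1) (h : Z) {ε : ℝ} (hε : 0 < ε) :
    ∃ δ > 0, ∀ t, 0 < t → t ≤ δ → (‖z + t • h‖ - 1) / t < normDeriv z h + ε := by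
  have : Nonempty (Set.Ioi (0 : ℝ)) := ⟨⟨1, Set.mem_Ioi.2 zero_lt_one⟩⟩
  obtain ⟨⟨δ, hδ⟩, h1⟩ := exists_lt_of_ciInf_lt
    (show normDeriv z h < normDeriv z h + ε by linarith)
  exact ⟨δ, hδ, fun t ht htδ => (normQuotient_mono hz h ht htδ).trans_lt h1⟩

lemma normDeriv_le_of_normQuotient_le {z : Z} (hz : ‖z‖ = 1) {h k : Z} {C δ : ℝ} (hδ : 0 < δ)
    (H : ∀ t, 0 < t → t < δ → (‖z + t • h‖ - 1) / t ≤ (‖z + t • k‖ - 1) / t + C) :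
    normDeriv z h ≤ normDeriv z k + C := by
  refine le_of_forall_pos_le_add fun ε hε => ?_
  obtain ⟨δ', hδ', h'⟩ := exists_normQuotient_lt hz k hε
  have hm : 0 < min (δ / 2) δ' := lt_min (by linarith) hδ'
  have h1 := h' _ hm (min_le_right _ _)
  have h2 := H _ hm ((min_le_left _ _).trans_lt (by linarith))
  linarith [normDeriv_le hz h hm]

lemma exists_normQuotient_lt_of_isCompact {z : Z} (hz : ‖z‖ = 1) {K : Set Z} (hK : IsCompact K)
    {ε : ℝ} (hε : 0 < ε) :
    ∃ δ > 0, ∀ t, 0 < t → t < δ → ∀ k ∈ K, (‖z + t • k‖ - 1) / t < normDeriv z k + ε := by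
  refine hK.induction_on (p := fun K => ∃ δ > 0, ∀ t, 0 < t → t < δ → ∀ k ∈ K,
    (‖z + t • k‖ - 1) / t < normDeriv z k + ε) ?_ ?_ ?_ ?_
  · exact ⟨1, zero_lt_one, by simp⟩
  · rintro s t hst ⟨δ, hδ, H⟩
    exact ⟨δ, hδ, fun r h0 h1 k hk => H r h0 h1 k (hst hk)⟩
  · rintro s t ⟨δ, hδ, H⟩ ⟨δ', hδ', H'⟩
    refine ⟨min δ δ', lt_min hδ hδ', fun r h0 h1 k hk => ?_⟩
    rcases hk with hk | hk
    · exact H r h0 (h1.trans_le (min_le_left _ _)) k hk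
    · exact H' r h0 (h1.trans_le (min_le_right _ _)) k hk
  · intro x _
    refine ⟨Metric.ball x (ε / 3), mem_nhdsWithin_of_mem_nhds (Metric.ball_mem_nhds _ (by linarith)),
      ?_⟩
    obtain ⟨δ, hδ, H⟩ := exists_normQuotient_lt hz x (ε := ε / 3) (by linarith)
    refine ⟨δ, hδ, fun t h0 h1 k hk => ?_⟩
    rw [mem_ball_iff_norm] at hk
    have a := H t h0 h1.le
    have b := normQuotient_lipschitz z k x h0
    have c := normDeriv_le_of_normQuotient_le hz zero_lt_one
      (fun t h0 _ => normQuotient_lipschitz z x k h0)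
    rw [norm_sub_rev] at c
    linarith

/-- The norm is SSD at `z` if, on functionals that are almost norming at `z`, the unit sphere can
be approximated by bounded subsets of finite-dimensional subspaces. -/
lemma isSSDPoint_of_finiteDimensional_approx {z : Z} (hz : ‖z‖ = 1) (R : ℝ)
    (H : ∀ ε > (0 : ℝ), ∃ W : Submodule ℝ Z, FiniteDimensional ℝ W ∧ ∃ δ > (0 : ℝ),
      ∀ h : Z, ‖h‖ = 1 → ∃ k ∈ W, ‖k‖ ≤ R ∧
        ∀ f : Z →L[ℝ] ℝ, ‖f‖ ≤ 1 → 1 - δ ≤ f z → |f (h - k)| ≤ ε) :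
    IsSSDPoint z := by
  have quot : ∀ (h k : Z) (ε δ t : ℝ), 0 < t → t * (2 * ‖h‖) ≤ δ →
      (∀ f : Z →L[ℝ] ℝ, ‖f‖ ≤ 1 → 1 - δ ≤ f z → |f (h - k)| ≤ ε) →
      (‖z + t • h‖ - 1) / t ≤ (‖z + t • k‖ - 1) / t + ε := by
    intro h k ε δ t ht htδ hf
    obtain ⟨f, hf1, hf2⟩ := exists_dual_vector'' ℝ (z + t • h)
    have hfb : ∀ x, |f x| ≤ ‖x‖ := fun x => by simpa using f.le_of_opNorm_le hf1 x
    have hf2' : f z + t * f h = ‖z + t • h‖ := by simpa using hf2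
    have hfh := (le_abs_self _).trans (hfb h)
    have hlow : 1 - t * ‖h‖ ≤ ‖z + t • h‖ := by
      have := neg_norm_le_normQuotient hz h ht
      rw [le_div_iff₀ ht] at this
      linarith
    have hmul := mul_le_mul_of_nonneg_left hfh ht.le
    have hfhk := (le_abs_self _).trans (hf f hf1 (by linarith))
    have hfk := (le_abs_self _).trans (hfb (z + t • k))
    rw [map_add, map_smul, smul_eq_mul] at hfk
    rw [map_sub] at hfhk
    have hmul2 := mul_le_mul_of_nonneg_left hfhk ht.le
    rw [div_add' _ _ _ ht.ne', div_le_div_iff_of_pos_right ht]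
    linarith
  refine ⟨hz, normDeriv z, fun ε hε => ?_⟩
  obtain ⟨W, hW, δ, hδ, hWδ⟩ := H (ε / 4) (by linarith)
  have : ProperSpace W := FiniteDimensional.proper ℝ W
  have hK : IsCompact ((↑) '' Metric.closedBall (0 : W) R : Set Z) :=
    (isCompact_closedBall _ _).image continuous_subtype_val
  obtain ⟨δ', hδ', hc⟩ := exists_normQuotient_lt_of_isCompact hz hK (ε := ε / 4) (by linarith)
  have hpos : 0 < δ / (2 * (|R| + 1)) := by positivity
  refine ⟨min δ' (δ / (2 * (|R| + 1))), lt_min hδ' hpos, fun t ht htlt h hh => ?_⟩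
  obtain ⟨k, hkW, hkR, hk⟩ := hWδ h hh
  have small : ∀ s, 0 < s → s < δ / (2 * (|R| + 1)) → ∀ x : Z, ‖x‖ ≤ |R| + 1 →
      s * (2 * ‖x‖) ≤ δ := by
    intro s hs hs' x hx
    rw [lt_div_iff₀ (by positivity)] at hs'
    have := mul_le_mul_of_nonneg_left hx hs.le
    linarith
  have hkn : ‖k‖ ≤ |R| + 1 := by linarith [le_abs_self R]
  have hhn : ‖h‖ ≤ |R| + 1 := by linarith [abs_nonneg R]
  have a1 := quot h k (ε / 4) δ t ht (small t ht (htlt.trans_le (min_le_right _ _)) h hhn) hk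
  have a2 := hc t ht (htlt.trans_le (min_le_left _ _)) k ⟨⟨k, hkW⟩, by simpa using hkR, rfl⟩
  have a3 : normDeriv z k ≤ normDeriv z h + ε / 4 :=
    normDeriv_le_of_normQuotient_le hz hpos fun s hs hs' =>
      quot k h (ε / 4) δ s hs (small s hs hs' k hkn) fun f hf hfz => by
        rw [← neg_sub, map_neg, abs_neg]; exact hk f hf hfz
  have a4 := normDeriv_le hz h ht
  rw [abs_lt]
  constructor <;> linarith

end DifferenceQuotient

section ProjectiveTensorProduct

variable {X Y Z : Type*} [NormedAddCommGroup X] [NormedSpace ℝ X]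
    [NormedAddCommGroup Y] [NormedSpace ℝ Y] [NormedAddCommGroup Z] [NormedSpace ℝ Z]

lemma exists_sum_of_mem_span_tensors (tp : X →ₗ[ℝ] Y →ₗ[ℝ] Z) {z : Z}
    (hz : z ∈ Submodule.span ℝ (Set.range fun xy : X × Y => tp xy.1 xy.2)) :
    ∃ (k : ℕ) (u : Fin k → X) (v : Fin k → Y), z = ∑ i, tp (u i) (v i) := by
  obtain ⟨k, c, g, rfl⟩ := Submodule.mem_span_set'.1 hz
  choose p hp using fun i => (g i).2
  refine ⟨k, fun i => c i • (p i).1, fun i => (p i).2, Finset.sum_congr rfl fun i _ => ?_⟩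
  rw [map_smul, LinearMap.smul_apply, ← hp i]

variable [CompleteSpace Z] {tp : X →ₗ[ℝ] Y →ₗ[ℝ] Z}

lemma IsProjectiveTensorProduct.norm_sum_le (htp : IsProjectiveTensorProduct tp) {k : ℕ}
    (u : Fin k → X) (v : Fin k → Y) : ‖∑ i, tp (u i) (v i)‖ ≤ ∑ i, ‖u i‖ * ‖v i‖ := by
  rw [htp.norm_eq]
  refine csInf_le ⟨0, ?_⟩ ⟨k, u, v, rfl, rfl⟩
  rintro _ ⟨k', u', v', -, rfl⟩
  positivity

lemma IsProjectiveTensorProduct.norm_apply_le (htp : IsProjectiveTensorProduct tp)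
    (x : X) (y : Y) : ‖tp x y‖ ≤ ‖x‖ * ‖y‖ := by
  simpa using htp.norm_sum_le (k := 1) (fun _ => x) (fun _ => y)

lemma IsProjectiveTensorProduct.exists_approx (htp : IsProjectiveTensorProduct tp) (z : Z)
    {η : ℝ} (hη : 0 < η) :
    ∃ (k : ℕ) (u : Fin k → X) (v : Fin k → Y), ‖z - ∑ i, tp (u i) (v i)‖ < η ∧
      ∑ i, ‖u i‖ * ‖v i‖ < ‖z‖ + 2 * η := by
  obtain ⟨w, hw, hzw⟩ := htp.dense_span.exists_dist_lt z hη
  rw [dist_eq_norm] at hzw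
  obtain ⟨k, u, v, rfl⟩ := exists_sum_of_mem_span_tensors tp hw
  have hn := htp.norm_eq k u v
  obtain ⟨_, ⟨k', u', v', e, rfl⟩, hlt⟩ := exists_lt_of_csInf_lt
    (s := projRepSums tp (∑ i, tp (u i) (v i))) (b := ‖∑ i, tp (u i) (v i)‖ + η)
    ⟨_, k, u, v, rfl, rfl⟩ (by linarith)
  refine ⟨k', u', v', e ▸ hzw, ?_⟩
  have := norm_sub_norm_le (∑ i, tp (u i) (v i)) z
  rw [norm_sub_rev] at this
  linarith

/-- The operator associated with a functional on the projective tensor product. -/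
lemma IsProjectiveTensorProduct.exists_operator (htp : IsProjectiveTensorProduct tp)
    (f : Z →L[ℝ] ℝ) (hf : ‖f‖ ≤ 1) :
    ∃ T : X →L[ℝ] Y →L[ℝ] ℝ, ‖T‖ ≤ 1 ∧ ∀ x y, T x y = f (tp x y) := by
  let B : X →ₗ[ℝ] Y →ₗ[ℝ] ℝ := tp.compr₂ (f : Z →ₗ[ℝ] ℝ)
  have hB : ∀ x y, ‖B x y‖ ≤ 1 * ‖x‖ * ‖y‖ := fun x y => by
    have := (f.le_of_opNorm_le hf (tp x y))
    rw [one_mul] at this ⊢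
    exact this.trans (htp.norm_apply_le x y)
  exact ⟨B.mkContinuous₂ 1 hB, B.mkContinuous₂_norm_le zero_le_one hB, fun x y => rfl⟩

end ProjectiveTensorProduct

lemma tp_c0Restrict_mem {I : Type*} [TopologicalSpace I] [DiscreteTopology I]
    {Y Z : Type*} [NormedAddCommGroup Y] [NormedSpace ℝ Y] [NormedAddCommGroup Z] [NormedSpace ℝ Z]
    (tp : ZeroAtInftyContinuousMap I ℝ →ₗ[ℝ] Y →ₗ[ℝ] Z) (A : Finset I)
    (x : ZeroAtInftyContinuousMap I ℝ) (y : Y) :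
    tp (c0Restrict A x) y ∈ A.sup fun a => LinearMap.range (tp (c0Single a)) := by
  rw [c0Restrict, map_sum, LinearMap.sum_apply]
  refine Submodule.sum_mem _ fun a ha => ?_
  rw [map_smul, LinearMap.smul_apply]
  exact Submodule.smul_mem _ _ (Finset.le_sup (f := fun a => LinearMap.range (tp (c0Single a))) ha
    (LinearMap.mem_range_self _ y))

/-- **Theorem 3.6.** Let `I` be an infinite (discrete) set and let `Y` be a finite-dimensional
smooth Banach space. Then the norm of `c₀(I) ⊗̂_π Y` is SSD at every point of its unit
sphere. -/
theorem ssd_of_projectiveTensorProduct_c0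
    (I : Type*) [TopologicalSpace I] [DiscreteTopology I] [Infinite I]
    (Y : Type*) [NormedAddCommGroup Y] [NormedSpace ℝ Y] [FiniteDimensional ℝ Y]
    (hY : SmoothNormedSpace Y)
    (Z : Type*) [NormedAddCommGroup Z] [NormedSpace ℝ Z] [CompleteSpace Z]
    (tp : ZeroAtInftyContinuousMap I ℝ →ₗ[ℝ] Y →ₗ[ℝ] Z)
    (htp : IsProjectiveTensorProduct tp) :
    ∀ z : Z, ‖z‖ = 1 → IsSSDPoint z := by
  intro z hz
  refine isSSDPoint_of_finiteDimensional_approx hz 3 fun ε hε => ?_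
  obtain ⟨c, hc1, hc⟩ := exists_lt_one_norm_lt_of_smooth hY (ε := ε / 12) (by linarith)
  have hm : max c 0 < 1 := max_lt hc1 zero_lt_one
  obtain ⟨η, hη, hηc⟩ : ∃ η > 0, max c 0 + 5 * η = 1 :=
    ⟨(1 - max c 0) / 5, by linarith, by ring⟩
  obtain ⟨k, u, v, hzuv, huv⟩ := htp.exists_approx z hη
  have hfin : (⋃ i, {j | 0 < ‖u i‖ ∧ ‖u i‖ / 2 < |u i j|}).Finite :=
    Set.finite_iUnion fun i => by
      by_cases hi : 0 < ‖u i‖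
      · simpa [hi] using finite_setOf_lt_abs_zeroAtInfty (u i) (half_pos hi)
      · simp [hi]
  set A : Finset I := hfin.toFinset
  refine ⟨A.sup fun a => LinearMap.range (tp (c0Single a)),
    Submodule.finiteDimensional_finset_sup _ _, η, hη, fun h hh => ?_⟩
  obtain ⟨m, a, b, hab, hsum⟩ := htp.exists_approx h (η := min (ε / 2) 1)
    (lt_min (by linarith) zero_lt_one)
  have hsum3 : ∑ i, ‖a i‖ * ‖b i‖ ≤ 3 := by
    have := min_le_right (ε / 2) 1
    linarith
  refine ⟨∑ i, tp (c0Restrict A (a i)) (b i), Submodule.sum_mem _ fun i _ =>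
    tp_c0Restrict_mem tp A (a i) (b i), ?_, fun f hf hfz => ?_⟩
  · refine (htp.norm_sum_le _ _).trans (le_trans ?_ hsum3)
    gcongr
    exact norm_c0Restrict_le _ _
  · obtain ⟨T, hT, hTf⟩ := htp.exists_operator f hf
    have hfb : ∀ x, |f x| ≤ ‖x‖ := fun x => by simpa using f.le_of_opNorm_le hf x
    obtain ⟨i, hui, hvi, hi⟩ : ∃ i, 0 < ‖u i‖ ∧ 0 < ‖v i‖ ∧
        c * (‖u i‖ * ‖v i‖) ≤ T (u i) (v i) := by
      by_contra! hcon
      have hle : ∀ i, T (u i) (v i) ≤ max c 0 * (‖u i‖ * ‖v i‖) := fun i => by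
        rcases (norm_nonneg (u i)).eq_or_lt with h0 | hu
        · rw [norm_eq_zero.1 h0.symm]; simp
        rcases (norm_nonneg (v i)).eq_or_lt with h0 | hv
        · rw [norm_eq_zero.1 h0.symm]; simp
        exact (hcon i hu hv).le.trans (by gcongr; exact le_max_left _ _)
      have h1 : f (∑ i, tp (u i) (v i)) ≤ max c 0 * ∑ i, ‖u i‖ * ‖v i‖ := by
        rw [map_sum, Finset.mul_sum]
        exact Finset.sum_le_sum fun i _ => (hTf _ _).symm.trans_le (hle i)
      have h2 := (le_abs_self _).trans (hfb (z - ∑ i, tp (u i) (v i)))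
      rw [map_sub] at h2
      have h3 : max c 0 * ∑ i, ‖u i‖ * ‖v i‖ ≤ max c 0 * (1 + 2 * η) := by
        gcongr
        linarith
      have h4 : max c 0 * (2 * η) ≤ 1 * (2 * η) := by gcongr
      linarith
    have hres : ∀ j, |T (a j - c0Restrict A (a j)) (b j)| ≤ ε / 6 * (‖a j‖ * ‖b j‖) := by
      intro j
      have hw := norm_apply_le_of_almost_norming hc T hT hui hvi hi (a j - c0Restrict A (a j))
        fun l hl => by
          have hlA : l ∈ A := hfin.mem_toFinset.2 (Set.mem_iUnion.2 ⟨i, hui, hl⟩)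
          rw [ZeroAtInftyContinuousMap.sub_apply, c0Restrict_apply, if_pos hlA, sub_self]
      have hw' : ‖T (a j - c0Restrict A (a j))‖ ≤ ε / 6 * ‖a j‖ := by
        refine hw.trans ?_
        have := mul_le_mul_of_nonneg_left (norm_sub_c0Restrict_le A (a j)) hε.le
        linarith
      rw [← mul_assoc]
      exact ContinuousLinearMap.le_of_opNorm_le _ hw' _
    have e : h - ∑ i, tp (c0Restrict A (a i)) (b i) = (h - ∑ i, tp (a i) (b i)) +
        ∑ i, tp (a i - c0Restrict A (a i)) (b i) := by
      simp only [map_sub, LinearMap.sub_apply, Finset.sum_sub_distrib]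
      abel
    rw [e, map_add, map_sum]
    refine (abs_add_le _ _).trans ?_
    have h1 := (hfb _).trans (hab.le.trans (min_le_left _ _))
    have h2 : |∑ i, f (tp (a i - c0Restrict A (a i)) (b i))| ≤ ε / 6 * 3 := by
      refine (Finset.abs_sum_le_sum_abs _ _).trans ?_
      calc _ ≤ ∑ i, ε / 6 * (‖a i‖ * ‖b i‖) :=
            Finset.sum_le_sum fun i _ => by rw [← hTf]; exact hres i
        _ ≤ ε / 6 * 3 := by rw [← Finset.mul_sum]; gcongr
    linarith
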